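/- arXiv:2310.09675 — 7 statements merged into one kernel-verified Lean document; each statement's English description precedes it below -/
import Mathlib

section
/- Let G₁ and G₂ be finite groups with permutation representations ρ₁ : G₁ → Sym(Fin d₁) and ρ₂ : G₂ → Sym(Fin d₂), with permutation matrices P₁(g), P₂(g) over ℝ, and for (g₁, g₂) let Q(g₁, g₂) be the block-diagonal matrix with blocks P₁(g₁) and P₂(g₂) acting on ℝ^{d₁} ⊕ ℝ^{d₂}. Then a square matrix L on the index type Fin d₁ ⊕ Fin d₂ satisfies L * Q(g₁, g₂) = Q(g₁, g₂) * L for all g₁ ∈ G₁, g₂ ∈ G₂ if and only if its blocks L = fromBlocks A B C D satisfy: A * P₁(g₁) = P₁(g₁) * A for all g₁; D * P₂(g₂) = P₂(g₂) * D for all g₂; P₁(g₁) * B = B and B * P₂(g₂) = B for all g₁, g₂; and P₂(g₂) * C = C and C * P₁(g₁) = C for all g₁, g₂. (Theorem 2: the multi-group equivariant layer characterizes the entire linear space satisfying the joint equivariance constraint.) -/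
open Matrix

/-- Commuting with a block-diagonal matrix, expressed on the four blocks. -/
theorem mul_fromBlocks_diagonal_comm_iff {m n R : Type*} [Fintype m] [Fintype n]
    [NonUnitalNonAssocSemiring R] (L : Matrix (m ⊕ n) (m ⊕ n) R)
    (P : Matrix m m R) (Q : Matrix n n R) :
    L * fromBlocks P 0 0 Q = fromBlocks P 0 0 Q * L ↔
      L.toBlocks₁₁ * P = P * L.toBlocks₁₁ ∧ L.toBlocks₁₂ * Q = P * L.toBlocks₁₂ ∧
        L.toBlocks₂₁ * P = Q * L.toBlocks₂₁ ∧ L.toBlocks₂₂ * Q = Q * L.toBlocks₂₂ := by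
  conv_lhs => rw [← fromBlocks_toBlocks L]
  simp [fromBlocks_multiply, fromBlocks_inj]

/-- **Theorem 2** (block characterization of the joint equivariant space).
A matrix `L` on `Fin d₁ ⊕ Fin d₂` commutes with every block-diagonal
`Q(g₁, g₂) = fromBlocks (P₁ g₁) 0 0 (P₂ g₂)` iff its four blocks
`A = L.toBlocks₁₁`, `B = L.toBlocks₁₂`, `C = L.toBlocks₂₁`, `D = L.toBlocks₂₂`
are respectively `G₁`-equivariant, `(G₂, G₁)`-invariant-symmetric,
`(G₁, G₂)`-invariant-symmetric, and `G₂`-equivariant. -/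
theorem joint_equivariant_block_characterization
    {G₁ G₂ : Type*} [Group G₁] [Group G₂] [Fintype G₁] [Fintype G₂]
    {d₁ d₂ : ℕ}
    (ρ₁ : G₁ →* Equiv.Perm (Fin d₁)) (ρ₂ : G₂ →* Equiv.Perm (Fin d₂))
    (L : Matrix (Fin d₁ ⊕ Fin d₂) (Fin d₁ ⊕ Fin d₂) ℝ) :
    (∀ (g₁ : G₁) (g₂ : G₂),
        L * Matrix.fromBlocks ((ρ₁ g₁).permMatrix ℝ) 0 0 ((ρ₂ g₂).permMatrix ℝ) =
          Matrix.fromBlocks ((ρ₁ g₁).permMatrix ℝ) 0 0 ((ρ₂ g₂).permMatrix ℝ) * L) ↔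
      ((∀ g₁ : G₁, L.toBlocks₁₁ * (ρ₁ g₁).permMatrix ℝ =
          (ρ₁ g₁).permMatrix ℝ * L.toBlocks₁₁) ∧
       (∀ g₂ : G₂, L.toBlocks₂₂ * (ρ₂ g₂).permMatrix ℝ =
          (ρ₂ g₂).permMatrix ℝ * L.toBlocks₂₂) ∧
       (∀ (g₁ : G₁) (g₂ : G₂),
          (ρ₁ g₁).permMatrix ℝ * L.toBlocks₁₂ = L.toBlocks₁₂ ∧
          L.toBlocks₁₂ * (ρ₂ g₂).permMatrix ℝ = L.toBlocks₁₂) ∧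
       (∀ (g₁ : G₁) (g₂ : G₂),
          (ρ₂ g₂).permMatrix ℝ * L.toBlocks₂₁ = L.toBlocks₂₁ ∧
          L.toBlocks₂₁ * (ρ₁ g₁).permMatrix ℝ = L.toBlocks₂₁)) := by
  simp only [mul_fromBlocks_diagonal_comm_iff]
  constructor
  · intro h
    have hB₁ (g₁ : G₁) : (ρ₁ g₁).permMatrix ℝ * L.toBlocks₁₂ = L.toBlocks₁₂ := by
      simpa using (h g₁ 1).2.1.symm
    have hB₂ (g₂ : G₂) : L.toBlocks₁₂ * (ρ₂ g₂).permMatrix ℝ = L.toBlocks₁₂ := by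
      simpa using (h 1 g₂).2.1
    have hC₁ (g₁ : G₁) : L.toBlocks₂₁ * (ρ₁ g₁).permMatrix ℝ = L.toBlocks₂₁ := by
      simpa using (h g₁ 1).2.2.1
    have hC₂ (g₂ : G₂) : (ρ₂ g₂).permMatrix ℝ * L.toBlocks₂₁ = L.toBlocks₂₁ := by
      simpa using (h 1 g₂).2.2.1.symm
    exact ⟨fun g₁ => (h g₁ 1).1, fun g₂ => (h 1 g₂).2.2.2,
      fun g₁ g₂ => ⟨hB₁ g₁, hB₂ g₂⟩, fun g₁ g₂ => ⟨hC₂ g₂, hC₁ g₁⟩⟩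
  · rintro ⟨hA, hD, hB, hC⟩ g₁ g₂
    exact ⟨hA g₁, (hB g₁ g₂).2.trans (hB g₁ g₂).1.symm,
      (hC g₁ g₂).2.trans (hC g₁ g₂).1.symm, hD g₂⟩
end

section
/- Let G₁ be a finite group acting on a set X and G₂ a finite group acting on a real normed vector space Y by linear isometries. Let f : X → Y be (G₁, G₂)-invariant-symmetric, let K ⊆ X, let K_sym = ⋃_{g₁∈G₁} {g₁ • x : x ∈ K}, and let ε > 0. If M : X → Y satisfies ‖M(x) − f(x)‖ ≤ ε for all x ∈ K_sym, then the invariant-symmetric averaging M^{IS}(x) = (1/(|G₁||G₂|)) · Σ_{g₂∈G₂} g₂ • (Σ_{g₁∈G₁} M(g₁ • x)) satisfies ‖M^{IS}(x) − f(x)‖ ≤ ε for all x ∈ K. -/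
/-- Key estimate for universality of the invariant-symmetric layer: if `M`
approximates the `(G₁, G₂)`-invariant-symmetric function `f` within `ε` on the
symmetrized set `K_sym = ⋃_{g₁} g₁ • K`, then the invariant-symmetric
averaging `M^{IS}` approximates `f` within `ε` on `K`. The group `G₂` acts on
the normed space `Y` by linear isometries. -/
theorem invariant_symmetric_averaging_approx
    {G₁ G₂ : Type*} [Group G₁] [Group G₂] [Fintype G₁] [Fintype G₂]
    {X : Type*} [MulAction G₁ X]
    {Y : Type*} [NormedAddCommGroup Y] [NormedSpace ℝ Y]
    [DistribMulAction G₂ Y] [SMulCommClass G₂ ℝ Y]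
    (hiso : ∀ (g₂ : G₂) (y : Y), ‖g₂ • y‖ = ‖y‖)
    (f : X → Y)
    (hfinv : ∀ (g₁ : G₁) (x : X), f (g₁ • x) = f x)
    (hfsym : ∀ (g₂ : G₂) (x : X), g₂ • f x = f x)
    (K : Set X) (Ksym : Set X)
    (hKsym : Ksym = ⋃ g₁ : G₁, (fun x => g₁ • x) '' K)
    (ε : ℝ) (hε : 0 < ε)
    (M : X → Y)
    (hM : ∀ x ∈ Ksym, ‖M x - f x‖ ≤ ε)
    (MIS : X → Y)
    (hMIS : ∀ x : X, MIS x =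
      ((Fintype.card G₁ : ℝ) * (Fintype.card G₂ : ℝ))⁻¹ •
        ∑ g₂ : G₂, g₂ • ∑ g₁ : G₁, M (g₁ • x)) :
    ∀ x ∈ K, ‖MIS x - f x‖ ≤ ε := by
  intro x hx
  have hcard : (0 : ℝ) < (Fintype.card G₁ : ℝ) * (Fintype.card G₂ : ℝ) := by
    exact_mod_cast Nat.mul_pos Fintype.card_pos Fintype.card_pos
  have hdiff : MIS x - f x = ((Fintype.card G₁ : ℝ) * (Fintype.card G₂ : ℝ))⁻¹ •
      ∑ g₂ : G₂, ∑ g₁ : G₁, g₂ • (M (g₁ • x) - f (g₁ • x)) := by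
    have hf : ∑ _g₂ : G₂, ∑ _g₁ : G₁, f x =
        ((Fintype.card G₁ : ℝ) * (Fintype.card G₂ : ℝ)) • f x := by
      simp only [Finset.sum_const, Finset.card_univ, ← Nat.cast_smul_eq_nsmul ℝ, smul_smul]
      rw [mul_comm]
    simp only [hMIS, smul_sub, hfinv, hfsym, Finset.sum_sub_distrib, Finset.smul_sum (r := (_ : G₂))]
    rw [hf, inv_smul_smul₀ hcard.ne']
  have hterm (g₂ : G₂) (g₁ : G₁) : ‖g₂ • (M (g₁ • x) - f (g₁ • x))‖ ≤ ε := by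
    rw [hiso]
    refine hM _ ?_
    rw [hKsym]
    exact Set.mem_iUnion.2 ⟨g₁, Set.mem_image_of_mem _ hx⟩
  rw [hdiff, norm_smul, norm_inv, Real.norm_of_nonneg hcard.le, inv_mul_le_iff₀ hcard]
  calc ‖∑ g₂ : G₂, ∑ g₁ : G₁, g₂ • (M (g₁ • x) - f (g₁ • x))‖
      ≤ ∑ _g₂ : G₂, ∑ _g₁ : G₁, ε :=
        norm_sum_le_of_le _ fun g₂ _ => norm_sum_le_of_le _ fun g₁ _ => hterm g₂ g₁
    _ = (Fintype.card G₁ : ℝ) * (Fintype.card G₂ : ℝ) * ε := by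
        simp only [Finset.sum_const, Finset.card_univ, nsmul_eq_mul]
        ring
end

section
/- Let X be a real normed vector space on which a finite group G₁ acts by linear isometries, and Y a real normed vector space on which a finite group G₂ acts by linear isometries. Let f : X → Y be continuous and (G₁, G₂)-invariant-symmetric. Let Θ be a type and M : Θ → (X → Y) a parametric family that is a universal approximator of f, i.e., for every compact K ⊆ X and ε > 0 there exists θ ∈ Θ with ‖f(x) − M(θ)(x)‖ < ε for all x ∈ K. Then the family θ ↦ M(θ)^{IS}, where M(θ)^{IS}(x) = (1/(|G₁||G₂|)) · Σ_{g₂∈G₂} g₂ • (Σ_{g₁∈G₁} M(θ)(g₁ • x)), is a universal approximator of f: for every compact K ⊆ X and ε > 0 there exists θ ∈ Θ with ‖f(x) − M(θ)^{IS}(x)‖ < ε for all x ∈ K. (Theorem 3: the invariant-symmetric layer is a universal approximator of invariant-symmetric functions.) -/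
/-- **Theorem 3** (universality of the invariant-symmetric layer).
If the parametric family `M : Θ → (X → Y)` is a universal approximator of the
continuous `(G₁, G₂)`-invariant-symmetric function `f`, then the family of
invariant-symmetric averagings
`M(θ)^{IS}(x) = (1/(|G₁||G₂|)) Σ_{g₂} g₂ • (Σ_{g₁} M(θ)(g₁ • x))`
is also a universal approximator of `f`. Both groups act by linear
isometries on the respective normed spaces. -/
theorem invariant_symmetric_layer_universal
    {G₁ G₂ : Type*} [Group G₁] [Group G₂] [Fintype G₁] [Fintype G₂]
    {X : Type*} [NormedAddCommGroup X] [NormedSpace ℝ X]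
    [DistribMulAction G₁ X] [SMulCommClass G₁ ℝ X]
    (hisoX : ∀ (g₁ : G₁) (x : X), ‖g₁ • x‖ = ‖x‖)
    {Y : Type*} [NormedAddCommGroup Y] [NormedSpace ℝ Y]
    [DistribMulAction G₂ Y] [SMulCommClass G₂ ℝ Y]
    (hisoY : ∀ (g₂ : G₂) (y : Y), ‖g₂ • y‖ = ‖y‖)
    (f : X → Y) (hfcont : Continuous f)
    (hfinv : ∀ (g₁ : G₁) (x : X), f (g₁ • x) = f x)
    (hfsym : ∀ (g₂ : G₂) (x : X), g₂ • f x = f x)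
    {Θ : Type*} (M : Θ → X → Y)
    (hM : ∀ K : Set X, IsCompact K → ∀ ε : ℝ, 0 < ε →
      ∃ θ : Θ, ∀ x ∈ K, ‖f x - M θ x‖ < ε)
    (MIS : Θ → X → Y)
    (hMIS : ∀ (θ : Θ) (x : X), MIS θ x =
      ((Fintype.card G₁ : ℝ) * (Fintype.card G₂ : ℝ))⁻¹ •
        ∑ g₂ : G₂, g₂ • ∑ g₁ : G₁, M θ (g₁ • x)) :
    ∀ K : Set X, IsCompact K → ∀ ε : ℝ, 0 < ε →
      ∃ θ : Θ, ∀ x ∈ K, ‖f x - MIS θ x‖ < ε := by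
  intro K hK ε hε
  have hcont : ∀ g : G₁, Continuous fun x : X => g • x := fun g =>
    (AddMonoidHomClass.isometry_of_norm (DistribSMul.toAddMonoidHom X g) (hisoX g)).continuous
  obtain ⟨θ, hθ⟩ := hM (⋃ g : G₁, (fun x : X => g • x) '' K)
    (isCompact_iUnion fun g => hK.image (hcont g)) ε hε
  refine ⟨θ, fun x hx => ?_⟩
  have hpoint : ∀ g : G₁, ‖f x - M θ (g • x)‖ < ε := fun g => by
    simpa only [hfinv] using hθ (g • x) (Set.mem_iUnion.2 ⟨g, x, hx, rfl⟩)
  have hcard : 0 < (Fintype.card G₁ : ℝ) * (Fintype.card G₂ : ℝ) := by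
    have h₁ : 0 < Fintype.card G₁ := Fintype.card_pos
    have h₂ : 0 < Fintype.card G₂ := Fintype.card_pos
    positivity
  have hsum : ∑ g₂ : G₂, g₂ • ∑ g₁ : G₁, (f x - M θ (g₁ • x)) =
      ((Fintype.card G₁ : ℝ) * (Fintype.card G₂ : ℝ)) • f x -
        ∑ g₂ : G₂, g₂ • ∑ g₁ : G₁, M θ (g₁ • x) := by
    simp only [Finset.smul_sum, smul_sub, hfsym, Finset.sum_sub_distrib]
    simp only [Finset.sum_const, Finset.card_univ, ← Nat.cast_smul_eq_nsmul ℝ, smul_smul]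
    rw [mul_comm]
  have hdiff : f x - MIS θ x = ((Fintype.card G₁ : ℝ) * (Fintype.card G₂ : ℝ))⁻¹ •
      ∑ g₂ : G₂, g₂ • ∑ g₁ : G₁, (f x - M θ (g₁ • x)) := by
    rw [hsum, smul_sub, inv_smul_smul₀ hcard.ne', hMIS]
  rw [hdiff, norm_smul, Real.norm_of_nonneg (inv_nonneg.2 hcard.le), inv_mul_lt_iff₀ hcard]
  calc ‖∑ g₂ : G₂, g₂ • ∑ g₁ : G₁, (f x - M θ (g₁ • x))‖
      ≤ ∑ _g₂ : G₂, ∑ g₁ : G₁, ‖f x - M θ (g₁ • x)‖ :=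
        norm_sum_le_of_le _ fun g₂ _ => (hisoY g₂ _).trans_le (norm_sum_le _ _)
    _ < ∑ _g₂ : G₂, ∑ _g₁ : G₁, ε :=
        Finset.sum_lt_sum_of_nonempty Finset.univ_nonempty fun _ _ =>
          Finset.sum_lt_sum_of_nonempty Finset.univ_nonempty fun g₁ _ => hpoint g₁
    _ = (Fintype.card G₁ : ℝ) * (Fintype.card G₂ : ℝ) * ε := by
        simp only [Finset.sum_const, Finset.card_univ, nsmul_eq_mul]
        ring
end

section
/- Let G₁ and G₂ be finite groups acting on a set X, and acting ℝ-linearly on a real vector space Y with commuting actions on Y (g₁ • (g₂ • y) = g₂ • (g₁ • y) for all g₁ ∈ G₁, g₂ ∈ G₂, y ∈ Y). Let c : X → X be G₁-invariant and G₂-equivariant (c(g₁ • x) = c(x) and c(g₂ • x) = g₂ • c(x)), and let M : X → Y be G₂-equivariant. Then the map F(x) = (1/|G₁|) · Σ_{h∈G₁} h • M(c(x)) satisfies F(g₁ • (g₂ • x)) = g₁ • (g₂ • F(x)) for all g₁ ∈ G₁, g₂ ∈ G₂, x ∈ X. (The key step in the proof of Theorem 4: symmetrizing over G₁ the image of a G₁-invariantized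 input under a G₂-equivariant model yields a map equivariant to the product group.) -/
/-- Key step of Theorem 4: if `c : X → X` is `G₁`-invariant and
`G₂`-equivariant and `M : X → Y` is `G₂`-equivariant, then the `G₁`-symmetrized
map `F(x) = (1/|G₁|) Σ_{h∈G₁} h • M(c x)` is equivariant to the product group:
`F(g₁ • g₂ • x) = g₁ • g₂ • F x`. -/
theorem product_group_key_step
    {G₁ G₂ : Type*} [Group G₁] [Group G₂] [Fintype G₁] [Fintype G₂]
    {X : Type*} [MulAction G₁ X] [MulAction G₂ X]
    {Y : Type*} [AddCommGroup Y] [Module ℝ Y]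
    [DistribMulAction G₁ Y] [SMulCommClass G₁ ℝ Y]
    [DistribMulAction G₂ Y] [SMulCommClass G₂ ℝ Y]
    (hcomm : ∀ (g₁ : G₁) (g₂ : G₂) (y : Y), g₁ • g₂ • y = g₂ • g₁ • y)
    (c : X → X)
    (hcinv : ∀ (g₁ : G₁) (x : X), c (g₁ • x) = c x)
    (hceq : ∀ (g₂ : G₂) (x : X), c (g₂ • x) = g₂ • c x)
    (M : X → Y)
    (hMeq : ∀ (g₂ : G₂) (x : X), M (g₂ • x) = g₂ • M x)
    (F : X → Y)
    (hF : ∀ x : X, F x = (Fintype.card G₁ : ℝ)⁻¹ • ∑ h : G₁, h • M (c x)) :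
    ∀ (g₁ : G₁) (g₂ : G₂) (x : X),
      F (g₁ • g₂ • x) = g₁ • g₂ • F x := by
  intro g₁ g₂ x
  have translate (y : Y) : ∑ h : G₁, g₁ • h • y = ∑ h : G₁, h • y :=
    Fintype.sum_equiv (Equiv.mulLeft g₁) _ _ fun h => by
      rw [Equiv.coe_mulLeft, mul_smul]
  rw [hF, hF, hcinv, hceq, hMeq, smul_comm g₂, smul_comm g₁, Finset.smul_sum (r := g₂)]
  simp_rw [← hcomm]
  rw [Finset.smul_sum (r := g₁), translate]
end

section
/- Let G₁ and G₂ be finite groups acting on a set X, and acting ℝ-linearly on a real vector space Y with commuting actions on Y (g₁ • (g₂ • y) = g₂ • (g₁ • y) for all g₁ ∈ G₁, g₂ ∈ G₂, y ∈ Y). Let c₁ : X → X be G₁-invariant and G₂-equivariant, c₂ : X → X be G₂-invariant and G₁-equivariant, M₂ : X → Y be G₂-equivariant, and M₁ : X → Y be G₁-equivariant. Then the map F(x) = (1/|G₁|) · Σ_{h∈G₁} h • M₂(c₁(x)) + (1/|G₂|) · Σ_{h∈G₂} h • M₁(c₂(x)) satisfies F(g₁ • (g₂ • x)) = g₁ •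 (g₂ • F(x)) for all g₁ ∈ G₁, g₂ ∈ G₂, x ∈ X. (Theorem 4: the efficient product-group design is equivariant to G₁ × G₂.) -/
/-- The sum of the translates of an element under a finite group is fixed by the group. -/
theorem smul_sum_univ_smul {G Y : Type*} [Group G] [Fintype G] [AddCommMonoid Y]
    [DistribMulAction G Y] (g : G) (y : Y) : g • ∑ h : G, h • y = ∑ h : G, h • y := by
  rw [Finset.smul_sum]
  exact Fintype.sum_equiv (Equiv.mulLeft g) _ _ fun h => by simp [mul_smul]

/-- Summing over a finite group commutes with any distributive action commuting with the group. -/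
theorem sum_univ_smul_smul_comm {G H Y : Type*} [Monoid H] [Fintype G] [AddCommMonoid Y]
    [SMul G Y] [DistribMulAction H Y]
    (hcomm : ∀ (g : G) (k : H) (y : Y), g • k • y = k • g • y) (k : H) (y : Y) :
    ∑ h : G, h • k • y = k • ∑ h : G, h • y := by
  simp only [hcomm, Finset.smul_sum]

/-- **Theorem 4** (equivariance of the efficient product-group design).
With `c₁` a `G₁`-invariant `G₂`-equivariant feature map, `c₂` a `G₂`-invariant
`G₁`-equivariant feature map, `M₂` a `G₂`-equivariant model and `M₁` a
`G₁`-equivariant model, the map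
`F(x) = (1/|G₁|) Σ_{h∈G₁} h • M₂(c₁ x) + (1/|G₂|) Σ_{h∈G₂} h • M₁(c₂ x)`
is equivariant to `G₁ × G₂`: `F(g₁ • g₂ • x) = g₁ • g₂ • F x`. -/
theorem product_group_design_equivariant
    {G₁ G₂ : Type*} [Group G₁] [Group G₂] [Fintype G₁] [Fintype G₂]
    {X : Type*} [MulAction G₁ X] [MulAction G₂ X]
    {Y : Type*} [AddCommGroup Y] [Module ℝ Y]
    [DistribMulAction G₁ Y] [SMulCommClass G₁ ℝ Y]
    [DistribMulAction G₂ Y] [SMulCommClass G₂ ℝ Y]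
    (hcomm : ∀ (g₁ : G₁) (g₂ : G₂) (y : Y), g₁ • g₂ • y = g₂ • g₁ • y)
    (c₁ : X → X)
    (hc₁inv : ∀ (g₁ : G₁) (x : X), c₁ (g₁ • x) = c₁ x)
    (hc₁eq : ∀ (g₂ : G₂) (x : X), c₁ (g₂ • x) = g₂ • c₁ x)
    (c₂ : X → X)
    (hc₂inv : ∀ (g₂ : G₂) (x : X), c₂ (g₂ • x) = c₂ x)
    (hc₂eq : ∀ (g₁ : G₁) (x : X), c₂ (g₁ • x) = g₁ • c₂ x)
    (M₂ : X → Y)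
    (hM₂eq : ∀ (g₂ : G₂) (x : X), M₂ (g₂ • x) = g₂ • M₂ x)
    (M₁ : X → Y)
    (hM₁eq : ∀ (g₁ : G₁) (x : X), M₁ (g₁ • x) = g₁ • M₁ x)
    (F : X → Y)
    (hF : ∀ x : X, F x =
      (Fintype.card G₁ : ℝ)⁻¹ • ∑ h : G₁, h • M₂ (c₁ x) +
        (Fintype.card G₂ : ℝ)⁻¹ • ∑ h : G₂, h • M₁ (c₂ x)) :
    ∀ (g₁ : G₁) (g₂ : G₂) (x : X),
      F (g₁ • g₂ • x) = g₁ • g₂ • F x := by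
  intro g₁ g₂ x
  rw [hF, hF, hc₁inv, hc₁eq, hM₂eq, hc₂eq, hc₂inv, hM₁eq,
    sum_univ_smul_smul_comm hcomm,
    sum_univ_smul_smul_comm (fun g k y => (hcomm k g y).symm)]
  simp only [smul_add, smul_comm g₁ (_ : ℝ), smul_comm g₂ (_ : ℝ)]
  rw [hcomm, smul_sum_univ_smul g₁, smul_sum_univ_smul g₂]
end

section
/- Let N be a natural number, and for each i ∈ Fin N let Gᵢ be a group acting on a set Xᵢ and acting by additive maps on an additive commutative group Yᵢ. For each i, let Mᵢ : Xᵢ → Yᵢ be Gᵢ-equivariant, and for each pair j ≠ i let M_{ji} : X_j → Yᵢ be (G_j, Gᵢ)-invariant-symmetric. Define Fᵢ(x₁, …, x_N) = Mᵢ(xᵢ) + Σ_{j≠i} M_{ji}(x_j). Then for all (g₁, …, g_N) with gₖ ∈ Gₖ and all inputs, Fᵢ(g₁ • x₁, …, g_N • x_N) = gᵢ • Fᵢ(x₁, …, x_N) for every i. (Appendix generalization of the multi-input equivariant design to N inputs.) -/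
/-- Appendix generalization of the multi-input equivariant design to `N`
inputs: with `Mᵢ : Xᵢ → Yᵢ` being `Gᵢ`-equivariant and, for each `j ≠ i`,
`M_{ji} : X_j → Yᵢ` being `(G_j, Gᵢ)`-invariant-symmetric, the layer
`Fᵢ(x₁, …, x_N) = Mᵢ(xᵢ) + Σ_{j≠i} M_{ji}(x_j)` satisfies
`Fᵢ(g₁ • x₁, …, g_N • x_N) = gᵢ • Fᵢ(x₁, …, x_N)` for every `i`. -/
theorem multi_input_N_equivariant
    {N : ℕ}
    {G : Fin N → Type*} [∀ i, Group (G i)]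
    {X : Fin N → Type*} [∀ i, MulAction (G i) (X i)]
    {Y : Fin N → Type*} [∀ i, AddCommGroup (Y i)]
    [∀ i, DistribMulAction (G i) (Y i)]
    (M : ∀ i, X i → Y i)
    (hM : ∀ (i : Fin N) (g : G i) (x : X i), M i (g • x) = g • M i x)
    (Mc : ∀ i j, X j → Y i)
    (hMcInv : ∀ (i j : Fin N), j ≠ i →
      ∀ (g : G j) (x : X j), Mc i j (g • x) = Mc i j x)
    (hMcSym : ∀ (i j : Fin N), j ≠ i →
      ∀ (g : G i) (x : X j), g • Mc i j x = Mc i j x)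
    (F : ∀ i, (∀ k, X k) → Y i)
    (hF : ∀ (i : Fin N) (x : ∀ k, X k),
      F i x = M i (x i) + ∑ j ∈ Finset.univ.erase i, Mc i j (x j)) :
    ∀ (g : ∀ k, G k) (x : ∀ k, X k) (i : Fin N),
      F i (fun k => g k • x k) = g i • F i x := by
  intro g x i
  rw [hF, hF, hM, smul_add, Finset.smul_sum]
  congr 1
  refine Finset.sum_congr rfl fun j hj => ?_
  have hji : j ≠ i := Finset.ne_of_mem_erase hj
  rw [hMcInv i j hji, hMcSym i j hji]
end

section
/- Let N be a natural number and for each i ∈ Fin N let Gᵢ be a finite group acting on a set X and acting ℝ-linearly on a real vector space Y, such that the actions of the different groups on Y pairwise commute. For each i, let cᵢ : X → X be G_j-invariant for every j ≠ i and Gᵢ-equivariant, and let Mᵢ : X → Y be Gᵢ-equivariant. Define F(x) = Σ_{i} (1/∏_{j≠i}|G_j|) · Σ over all tuples (h_j)_{j≠i} with h_j ∈ G_j of (h applied in sequence) • Mᵢ(cᵢ(x)), i.e., each term symmetrizes Mᵢ(cᵢ(x)) over all groups other than Gᵢ. Then F(g₁ • g₂ • ⋯ • g_N • x) = g₁ •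 g₂ • ⋯ • g_N • F(x) for all gₖ ∈ Gₖ and x ∈ X. (Appendix generalization of the efficient product-group equivariant design to N groups, equation (6).) -/
section FoldrSMul

variable {ι : Type*} {G : ι → Type*} {Y : Type*}

theorem List.foldr_smul_comm_of_notMem [∀ i, Monoid (G i)] [∀ i, MulAction (G i) Y]
    (hcomm : ∀ i j, i ≠ j → ∀ (a : G i) (b : G j) (y : Y), a • b • y = b • a • y)
    (g : ∀ k, G k) {i : ι} (a : G i) {l : List ι} (hi : i ∉ l) (y : Y) :
    l.foldr (fun k z => g k • z) (a • y) = a • l.foldr (fun k z => g k • z) y := by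
  induction l with
  | nil => rfl
  | cons k l ih =>
    rw [List.mem_cons, not_or] at hi
    simp only [List.foldr_cons]
    rw [ih hi.2, hcomm i k hi.1]

theorem List.foldr_smul_foldr_smul [∀ i, Monoid (G i)] [∀ i, MulAction (G i) Y]
    (hcomm : ∀ i j, i ≠ j → ∀ (a : G i) (b : G j) (y : Y), a • b • y = b • a • y)
    (g h : ∀ k, G k) {l : List ι} (hl : l.Nodup) (y : Y) :
    l.foldr (fun k z => g k • z) (l.foldr (fun k z => h k • z) y) =
      l.foldr (fun k z => (g * h) k • z) y := by
  induction l with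
  | nil => rfl
  | cons k l ih =>
    rw [List.nodup_cons] at hl
    simp only [List.foldr_cons]
    rw [List.foldr_smul_comm_of_notMem hcomm g (h k) hl.1, ih hl.2, Pi.mul_apply, mul_smul]

/-- A map that intertwines the action of `G i` and is invariant under every other factor sees only
the `i`-th component of an iterated action. -/
theorem List.map_foldr_smul {Z : Type*} [DecidableEq ι] [∀ i, SMul (G i) Y] {i : ι} [SMul (G i) Z]
    (f : Y → Z) (hinv : ∀ j, j ≠ i → ∀ (a : G j) (y : Y), f (a • y) = f y)
    (heq : ∀ (a : G i) (y : Y), f (a • y) = a • f y)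
    (g : ∀ k, G k) {l : List ι} (hl : l.Nodup) (y : Y) :
    f (l.foldr (fun k z => g k • z) y) = if i ∈ l then g i • f y else f y := by
  induction l with
  | nil => simp
  | cons k l ih =>
    rw [List.nodup_cons] at hl
    rw [List.foldr_cons]
    by_cases hk : k = i
    · subst hk
      rw [heq, ih hl.2, if_neg hl.1, if_pos List.mem_cons_self]
    · rw [hinv k hk, ih hl.2]
      simp [Ne.symm hk]

theorem List.foldr_mulSingle_smul [DecidableEq ι] [∀ i, Monoid (G i)] [∀ i, MulAction (G i) Y]
    {i : ι} (a : G i) {l : List ι} (hl : l.Nodup) (y : Y) :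
    l.foldr (fun k z => (Pi.mulSingle i a : ∀ k, G k) k • z) y = if i ∈ l then a • y else y := by
  induction l with
  | nil => simp
  | cons k l ih =>
    rw [List.nodup_cons] at hl
    rw [List.foldr_cons, ih hl.2]
    by_cases hk : k = i
    · subst hk
      simp [hl.1]
    · simp [hk, Ne.symm hk]

theorem List.foldr_smul_sum [AddCommMonoid Y] [∀ i, Monoid (G i)]
    [∀ i, DistribMulAction (G i) Y] (g : ∀ k, G k) (l : List ι) {α : Type*} (s : Finset α)
    (f : α → Y) :
    l.foldr (fun k z => g k • z) (∑ a ∈ s, f a) = ∑ a ∈ s, l.foldr (fun k z => g k • z) (f a) := by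
  induction l with
  | nil => rfl
  | cons k l ih => simp only [List.foldr_cons, ih, Finset.smul_sum]

theorem List.foldr_smul_smul {R : Type*} [SMul R Y] [∀ i, SMul (G i) Y]
    [∀ i, SMulCommClass (G i) R Y] (g : ∀ k, G k) (l : List ι) (r : R) (y : Y) :
    l.foldr (fun k z => g k • z) (r • y) = r • l.foldr (fun k z => g k • z) y := by
  induction l with
  | nil => rfl
  | cons k l ih => simp only [List.foldr_cons, ih, smul_comm]

/-- Iterating the actions of all factors other than `G i` and then those of all factors translates
the tuple of the former and moves the `i`-th component to the inside. -/
theorem List.foldr_smul_foldr_dite_smul [DecidableEq ι] [∀ i, Monoid (G i)]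
    [∀ i, MulAction (G i) Y]
    (hcomm : ∀ i j, i ≠ j → ∀ (a : G i) (b : G j) (y : Y), a • b • y = b • a • y)
    (g : ∀ k, G k) {i : ι} (h : ∀ j : {j : ι // j ≠ i}, G j) {l : List ι} (hl : l.Nodup)
    (hi : i ∈ l) (y : Y) :
    l.foldr (fun k z => g k • z)
        (l.foldr (fun j z => if hj : j = i then z else h ⟨j, hj⟩ • z) y) =
      l.foldr (fun j z => if hj : j = i then z else (g j * h ⟨j, hj⟩) • z) (g i • y) := by
  have extend (h : ∀ j : {j : ι // j ≠ i}, G j) :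
      (fun (j : ι) (z : Y) => if hj : j = i then z else h ⟨j, hj⟩ • z) =
        fun j z => (if hj : j = i then 1 else h ⟨j, hj⟩ : G j) • z := by
    funext j z
    split_ifs <;> simp
  have single := List.foldr_mulSingle_smul (G := G) (g i) hl y
  rw [if_pos hi] at single
  rw [extend h, extend fun j => g j * h j, ← single, List.foldr_smul_foldr_smul hcomm _ _ hl,
    List.foldr_smul_foldr_smul hcomm _ _ hl]
  congr 1
  funext j z
  by_cases hj : j = i
  · subst hj
    simp
  · simp [hj]

end FoldrSMul

/-- Appendix generalization of the efficient product-group design to `N`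
groups (equation (6)): each term symmetrizes `Mᵢ(cᵢ(x))` over all tuples
`(h_j)_{j≠i}` of elements of the groups other than `Gᵢ` (applied in
sequence), and the resulting sum `F` is equivariant to the product
`G₁ × ⋯ × G_N`, i.e. `F(g₁ • g₂ • ⋯ • g_N • x) = g₁ • g₂ • ⋯ • g_N • F(x)`. -/
theorem product_group_design_N_equivariant
    {N : ℕ}
    {G : Fin N → Type*} [∀ i, Group (G i)] [∀ i, Fintype (G i)]
    {X : Type*} [∀ i, MulAction (G i) X]
    {Y : Type*} [AddCommGroup Y] [Module ℝ Y]
    [∀ i, DistribMulAction (G i) Y] [∀ i, SMulCommClass (G i) ℝ Y]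
    (hcomm : ∀ (i j : Fin N), i ≠ j →
      ∀ (gi : G i) (gj : G j) (y : Y), gi • gj • y = gj • gi • y)
    (c : Fin N → X → X)
    (hcInv : ∀ (i j : Fin N), j ≠ i → ∀ (g : G j) (x : X), c i (g • x) = c i x)
    (hcEq : ∀ (i : Fin N) (g : G i) (x : X), c i (g • x) = g • c i x)
    (M : Fin N → X → Y)
    (hMEq : ∀ (i : Fin N) (g : G i) (x : X), M i (g • x) = g • M i x)
    (F : X → Y)
    (hF : ∀ x : X, F x =
      ∑ i : Fin N,
        (∏ j ∈ Finset.univ.erase i, (Fintype.card (G j) : ℝ))⁻¹ •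
          ∑ h : (∀ j : {j : Fin N // j ≠ i}, G j),
            (List.finRange N).foldr
              (fun j y => if hj : j = i then y else h ⟨j, hj⟩ • y)
              (M i (c i x))) :
    ∀ (g : ∀ k, G k) (x : X),
      F ((List.finRange N).foldr (fun k x' => g k • x') x) =
        (List.finRange N).foldr (fun k y => g k • y) (F x) := by
  intro g x
  rw [hF, hF, List.foldr_smul_sum]
  refine Finset.sum_congr rfl fun i _ => ?_
  rw [List.foldr_smul_smul, List.foldr_smul_sum,
    List.map_foldr_smul (c i) (hcInv i) (hcEq i) g (List.nodup_finRange N),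
    if_pos (List.mem_finRange i), hMEq]
  congr 1
  refine (Fintype.sum_equiv (Equiv.mulLeft fun j : {j : Fin N // j ≠ i} => g j) _ _
    fun h => ?_).symm
  exact List.foldr_smul_foldr_dite_smul hcomm g h (List.nodup_finRange N) (List.mem_finRange i) _
end
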